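/- Let A be a right weak bimonoid in a duoidal category (M,∘,I,•,J) in which idempotent morphisms split, and define ϑ^R := ((J∘A)•ϖ).((J∘A)•(J∘(ε.μ))).ζ.(J∘A∘Δ) : J∘A∘A → J∘A. Then the diagram consisting of the parallel pair (J∘μ, ϑ^R) : J∘A∘A → J∘A followed by π^R_∘ : J∘A → R_∘ is a contractible coequalizer of left J-modules: (i) π^R_∘.(J∘μ) = π^R_∘.ϑ^R; (ii) ϑ^R.(J∘A∘η) = ι^R_∘.π^R_∘ = ⊓^R_∘; (iii) (J∘μ).(J∘A∘η) = id and π^R_∘.ι^R_∘ = id; and all the morphisms J∘μ, ϑ^R, π^R_∘, J∘A∘η, ι^R_∘ are morphisms of left J-modules (J acting on J∘A∘A and J∘A by ϖ∘− and on R_∘ by γ_J). -/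

import Mathlib

open CategoryTheory

universe v u

/-- A (strict) duoidal category structure on a category `M`: two strict monoidal
structures `co` (the first monoidal product `∘` with unit `uI`) and `bu` (the second
monoidal product `•` with unit `uJ`), together with the structure morphisms
`dlI : I ⟶ I • I`, `pw : J ∘ J ⟶ J`, `tau : I ⟶ J` and the interchange law `zt`,
subject to the axioms of a duoidal category. -/
structure Duo (M : Type u) [Category.{v} M] where
  co : M → M → M
  coh : ∀ {X₁ Y₁ X₂ Y₂ : M}, (X₁ ⟶ Y₁) → (X₂ ⟶ Y₂) → (co X₁ X₂ ⟶ co Y₁ Y₂)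
  uI : M
  bu : M → M → M
  buh : ∀ {X₁ Y₁ X₂ Y₂ : M}, (X₁ ⟶ Y₁) → (X₂ ⟶ Y₂) → (bu X₁ X₂ ⟶ bu Y₁ Y₂)
  uJ : M
  coA : ∀ X Y Z, co (co X Y) Z = co X (co Y Z)
  coL : ∀ X, co uI X = X
  coR : ∀ X, co X uI = X
  buA : ∀ X Y Z, bu (bu X Y) Z = bu X (bu Y Z)
  buL : ∀ X, bu uJ X = X
  buR : ∀ X, bu X uJ = X
  coh_id : ∀ X Y, coh (𝟙 X) (𝟙 Y) = 𝟙 (co X Y)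
  coh_comp : ∀ {X₁ Y₁ Z₁ X₂ Y₂ Z₂ : M} (f₁ : X₁ ⟶ Y₁) (g₁ : Y₁ ⟶ Z₁) (f₂ : X₂ ⟶ Y₂)
    (g₂ : Y₂ ⟶ Z₂), coh (f₁ ≫ g₁) (f₂ ≫ g₂) = coh f₁ f₂ ≫ coh g₁ g₂
  buh_id : ∀ X Y, buh (𝟙 X) (𝟙 Y) = 𝟙 (bu X Y)
  buh_comp : ∀ {X₁ Y₁ Z₁ X₂ Y₂ Z₂ : M} (f₁ : X₁ ⟶ Y₁) (g₁ : Y₁ ⟶ Z₁) (f₂ : X₂ ⟶ Y₂)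
    (g₂ : Y₂ ⟶ Z₂), buh (f₁ ≫ g₁) (f₂ ≫ g₂) = buh f₁ f₂ ≫ buh g₁ g₂
  coh_assoc : ∀ {X₁ Y₁ X₂ Y₂ X₃ Y₃ : M} (f₁ : X₁ ⟶ Y₁) (f₂ : X₂ ⟶ Y₂) (f₃ : X₃ ⟶ Y₃),
    coh (coh f₁ f₂) f₃
      = eqToHom (coA X₁ X₂ X₃) ≫ coh f₁ (coh f₂ f₃) ≫ eqToHom (coA Y₁ Y₂ Y₃).symm
  coh_unitL : ∀ {X Y : M} (f : X ⟶ Y),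
    coh (𝟙 uI) f = eqToHom (coL X) ≫ f ≫ eqToHom (coL Y).symm
  coh_unitR : ∀ {X Y : M} (f : X ⟶ Y),
    coh f (𝟙 uI) = eqToHom (coR X) ≫ f ≫ eqToHom (coR Y).symm
  buh_assoc : ∀ {X₁ Y₁ X₂ Y₂ X₃ Y₃ : M} (f₁ : X₁ ⟶ Y₁) (f₂ : X₂ ⟶ Y₂) (f₃ : X₃ ⟶ Y₃),
    buh (buh f₁ f₂) f₃
      = eqToHom (buA X₁ X₂ X₃) ≫ buh f₁ (buh f₂ f₃) ≫ eqToHom (buA Y₁ Y₂ Y₃).symm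
  buh_unitL : ∀ {X Y : M} (f : X ⟶ Y),
    buh (𝟙 uJ) f = eqToHom (buL X) ≫ f ≫ eqToHom (buL Y).symm
  buh_unitR : ∀ {X Y : M} (f : X ⟶ Y),
    buh f (𝟙 uJ) = eqToHom (buR X) ≫ f ≫ eqToHom (buR Y).symm
  dlI : uI ⟶ bu uI uI
  pw : co uJ uJ ⟶ uJ
  tau : uI ⟶ uJ
  zt : ∀ A B C D : M, co (bu A B) (bu C D) ⟶ bu (co A C) (co B D)
  zt_nat : ∀ {A A' B B' C C' D D' : M} (f : A ⟶ A') (g : B ⟶ B') (h : C ⟶ C')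
    (k : D ⟶ D'),
    coh (buh f g) (buh h k) ≫ zt A' B' C' D' = zt A B C D ≫ buh (coh f h) (coh g k)
  pw_assoc : coh pw (𝟙 uJ) ≫ pw = eqToHom (coA uJ uJ uJ) ≫ coh (𝟙 uJ) pw ≫ pw
  pw_unitL : eqToHom (coL uJ).symm ≫ coh tau (𝟙 uJ) ≫ pw = 𝟙 uJ
  pw_unitR : eqToHom (coR uJ).symm ≫ coh (𝟙 uJ) tau ≫ pw = 𝟙 uJ
  dlI_coassoc : dlI ≫ buh dlI (𝟙 uI) ≫ eqToHom (buA uI uI uI) = dlI ≫ buh (𝟙 uI) dlI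
  dlI_counitL : dlI ≫ buh tau (𝟙 uI) ≫ eqToHom (buL uI) = 𝟙 uI
  dlI_counitR : dlI ≫ buh (𝟙 uI) tau ≫ eqToHom (buR uI) = 𝟙 uI
  zt_assoc1 : ∀ A B C D E F : M,
    coh (zt A B C D) (𝟙 (bu E F)) ≫ zt (co A C) (co B D) E F
      = eqToHom (coA (bu A B) (bu C D) (bu E F)) ≫ coh (𝟙 (bu A B)) (zt C D E F)
          ≫ zt A B (co C E) (co D F)
          ≫ eqToHom (show bu (co A (co C E)) (co B (co D F))
              = bu (co (co A C) E) (co (co B D) F) by simp [coA])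
  zt_assoc2 : ∀ A B C D E F : M,
    zt (bu A B) C (bu D E) F ≫ buh (zt A B D E) (𝟙 (co C F))
      = eqToHom (show co (bu (bu A B) C) (bu (bu D E) F)
            = co (bu A (bu B C)) (bu D (bu E F)) by simp [buA])
          ≫ zt A (bu B C) D (bu E F) ≫ buh (𝟙 (co A D)) (zt B C E F)
          ≫ eqToHom (buA (co A D) (co B E) (co C F)).symm
  zt_unitA : ∀ A B : M,
    eqToHom (coL (bu A B)).symm ≫ coh dlI (𝟙 (bu A B)) ≫ zt uI uI A B
      ≫ eqToHom (show bu (co uI A) (co uI B) = bu A B by simp [coL]) = 𝟙 (bu A B)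
  zt_unitB : ∀ A B : M,
    eqToHom (coR (bu A B)).symm ≫ coh (𝟙 (bu A B)) dlI ≫ zt A B uI uI
      ≫ eqToHom (show bu (co A uI) (co B uI) = bu A B by simp [coR]) = 𝟙 (bu A B)
  zt_unitC : ∀ A B : M,
    eqToHom (show co A B = co (bu uJ A) (bu uJ B) by simp [buL]) ≫ zt uJ A uJ B
      ≫ buh pw (𝟙 (co A B)) ≫ eqToHom (buL (co A B)) = 𝟙 (co A B)
  zt_unitD : ∀ A B : M,
    eqToHom (show co A B = co (bu A uJ) (bu B uJ) by simp [buR]) ≫ zt A uJ B uJ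
      ≫ buh (𝟙 (co A B)) pw ≫ eqToHom (buR (co A B)) = 𝟙 (co A B)

namespace Duo

variable {M : Type u} [Category.{v} M] (D : Duo M)

/-- Axiom (WB): the multiplication is comultiplicative. -/
def WBeq (A : M) (mu : D.co A A ⟶ A) (dl : A ⟶ D.bu A A) : Prop :=
  mu ≫ dl = D.coh dl dl ≫ D.zt A A A A ≫ D.buh mu mu

/-- Axiom (RRU). -/
def RRUeq (A : M) (mu : D.co A A ⟶ A) (eta : D.uI ⟶ A) (dl : A ⟶ D.bu A A) : Prop :=
  D.dlI ≫ D.buh (𝟙 D.uI) (eta ≫ dl)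
    ≫ eqToHom (show D.bu D.uI (D.bu A A) = D.bu (D.co (D.bu D.uI A) D.uI) A by
        simp [D.coR, D.buA])
    ≫ D.buh (D.coh (𝟙 (D.bu D.uI A)) D.dlI) (𝟙 A)
    ≫ D.buh (D.coh (𝟙 (D.bu D.uI A)) (D.buh (𝟙 D.uI) (eta ≫ dl))) (𝟙 A)
    ≫ eqToHom (show D.bu (D.co (D.bu D.uI A) (D.bu D.uI (D.bu A A))) A
        = D.bu (D.co (D.bu D.uI A) (D.bu (D.bu D.uI A) A)) A by simp [D.buA])
    ≫ D.buh (D.zt D.uI A (D.bu D.uI A) A) (𝟙 A)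
    ≫ eqToHom (show D.bu (D.bu (D.co D.uI (D.bu D.uI A)) (D.co A A)) A
        = D.bu (D.bu (D.bu D.uI A) (D.co A A)) A by simp [D.coL])
    ≫ D.buh (D.buh (𝟙 (D.bu D.uI A)) mu) (𝟙 A)
  = D.dlI ≫ D.buh (𝟙 D.uI) eta ≫ D.buh (𝟙 D.uI) dl
    ≫ eqToHom (show D.bu D.uI (D.bu A A) = D.bu (D.bu D.uI A) A by simp [D.buA])
    ≫ D.buh (𝟙 (D.bu D.uI A)) dl
    ≫ eqToHom (show D.bu (D.bu D.uI A) (D.bu A A)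
        = D.bu (D.bu (D.bu D.uI A) A) A by simp [D.buA])

/-- Axiom (LRU). -/
def LRUeq (A : M) (mu : D.co A A ⟶ A) (eta : D.uI ⟶ A) (dl : A ⟶ D.bu A A) : Prop :=
  D.dlI ≫ D.buh (eta ≫ dl) (𝟙 D.uI)
    ≫ eqToHom (show D.bu (D.bu A A) D.uI = D.bu A (D.co (D.bu A D.uI) D.uI) by
        simp [D.coR, D.buA])
    ≫ D.buh (𝟙 A) (D.coh (𝟙 (D.bu A D.uI)) D.dlI)
    ≫ D.buh (𝟙 A) (D.coh (𝟙 (D.bu A D.uI)) (D.buh (eta ≫ dl) (𝟙 D.uI)))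
    ≫ eqToHom (show D.bu A (D.co (D.bu A D.uI) (D.bu (D.bu A A) D.uI))
        = D.bu A (D.co (D.bu A D.uI) (D.bu A (D.bu A D.uI))) by simp [D.buA])
    ≫ D.buh (𝟙 A) (D.zt A D.uI A (D.bu A D.uI))
    ≫ eqToHom (show D.bu A (D.bu (D.co A A) (D.co D.uI (D.bu A D.uI)))
        = D.bu (D.bu (D.bu A (D.co A A)) A) D.uI by simp [D.coL, D.buA])
    ≫ D.buh (D.buh (D.buh (𝟙 A) mu) (𝟙 A)) (𝟙 D.uI)
  = D.dlI ≫ D.buh eta (𝟙 D.uI) ≫ D.buh dl (𝟙 D.uI) ≫ D.buh (D.buh dl (𝟙 A)) (𝟙 D.uI)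

/-- Axiom (LRC). -/
def LRCeq (A : M) (mu : D.co A A ⟶ A) (dl : A ⟶ D.bu A A) (ep : A ⟶ D.uJ) : Prop :=
  D.coh (D.coh (𝟙 (D.co D.uJ A)) dl) (𝟙 A)
    ≫ eqToHom (show D.co (D.co (D.co D.uJ A) (D.bu A A)) A
        = D.co (D.co (D.bu (D.co D.uJ A) D.uJ) (D.bu A A)) A by simp [D.buR])
    ≫ D.coh (D.zt (D.co D.uJ A) D.uJ A A) (𝟙 A)
    ≫ D.coh (D.buh (eqToHom (D.coA D.uJ A A) ≫ D.coh (𝟙 D.uJ) (mu ≫ ep))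
        (𝟙 (D.co D.uJ A))) (𝟙 A)
    ≫ D.coh (D.buh D.pw (𝟙 (D.co D.uJ A))) (𝟙 A)
    ≫ eqToHom (show D.co (D.bu D.uJ (D.co D.uJ A)) A = D.co D.uJ (D.co A A) by
        simp [D.buL, D.coA])
    ≫ D.coh (𝟙 D.uJ) (mu ≫ ep) ≫ D.pw
  = eqToHom (show D.co (D.co (D.co D.uJ A) A) A = D.co (D.co D.uJ A) (D.co A A) by
        simp [D.coA])
    ≫ D.coh (𝟙 (D.co D.uJ A)) mu
    ≫ eqToHom (D.coA D.uJ A A)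
    ≫ D.coh (𝟙 D.uJ) mu ≫ D.coh (𝟙 D.uJ) ep ≫ D.pw

/-- Axiom (LLC). -/
def LLCeq (A : M) (mu : D.co A A ⟶ A) (dl : A ⟶ D.bu A A) (ep : A ⟶ D.uJ) : Prop :=
  D.coh (D.coh (𝟙 (D.co D.uJ A)) dl) (𝟙 A)
    ≫ eqToHom (show D.co (D.co (D.co D.uJ A) (D.bu A A)) A
        = D.co (D.co (D.bu D.uJ (D.co D.uJ A)) (D.bu A A)) A by simp [D.buL])
    ≫ D.coh (D.zt D.uJ (D.co D.uJ A) A A) (𝟙 A)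
    ≫ D.coh (D.buh (𝟙 (D.co D.uJ A))
        (eqToHom (D.coA D.uJ A A) ≫ D.coh (𝟙 D.uJ) (mu ≫ ep))) (𝟙 A)
    ≫ D.coh (D.buh (𝟙 (D.co D.uJ A)) D.pw) (𝟙 A)
    ≫ eqToHom (show D.co (D.bu (D.co D.uJ A) D.uJ) A = D.co D.uJ (D.co A A) by
        simp [D.buR, D.coA])
    ≫ D.coh (𝟙 D.uJ) (mu ≫ ep) ≫ D.pw
  = eqToHom (show D.co (D.co (D.co D.uJ A) A) A = D.co (D.co D.uJ A) (D.co A A) by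
        simp [D.coA])
    ≫ D.coh (𝟙 (D.co D.uJ A)) mu
    ≫ eqToHom (D.coA D.uJ A A)
    ≫ D.coh (𝟙 D.uJ) mu ≫ D.coh (𝟙 D.uJ) ep ≫ D.pw

/-- Axiom (RLU), obtained from (RRU) by replacing `∘` by its opposite. -/
def RLUeq (A : M) (mu : D.co A A ⟶ A) (eta : D.uI ⟶ A) (dl : A ⟶ D.bu A A) : Prop :=
  D.dlI ≫ D.buh (𝟙 D.uI) (eta ≫ dl)
    ≫ eqToHom (show D.bu D.uI (D.bu A A) = D.bu (D.co D.uI (D.bu D.uI A)) A by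
        simp [D.coL, D.buA])
    ≫ D.buh (D.coh D.dlI (𝟙 (D.bu D.uI A))) (𝟙 A)
    ≫ D.buh (D.coh (D.buh (𝟙 D.uI) (eta ≫ dl)) (𝟙 (D.bu D.uI A))) (𝟙 A)
    ≫ eqToHom (show D.bu (D.co (D.bu D.uI (D.bu A A)) (D.bu D.uI A)) A
        = D.bu (D.co (D.bu (D.bu D.uI A) A) (D.bu D.uI A)) A by simp [D.buA])
    ≫ D.buh (D.zt (D.bu D.uI A) A D.uI A) (𝟙 A)
    ≫ eqToHom (show D.bu (D.bu (D.co (D.bu D.uI A) D.uI) (D.co A A)) A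
        = D.bu (D.bu (D.bu D.uI A) (D.co A A)) A by simp [D.coR])
    ≫ D.buh (D.buh (𝟙 (D.bu D.uI A)) mu) (𝟙 A)
  = D.dlI ≫ D.buh (𝟙 D.uI) eta ≫ D.buh (𝟙 D.uI) dl
    ≫ eqToHom (show D.bu D.uI (D.bu A A) = D.bu (D.bu D.uI A) A by simp [D.buA])
    ≫ D.buh (𝟙 (D.bu D.uI A)) dl
    ≫ eqToHom (show D.bu (D.bu D.uI A) (D.bu A A)
        = D.bu (D.bu (D.bu D.uI A) A) A by simp [D.buA])

/-- Axiom (LLU), obtained from (LRU) by replacing `∘` by its opposite. -/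
def LLUeq (A : M) (mu : D.co A A ⟶ A) (eta : D.uI ⟶ A) (dl : A ⟶ D.bu A A) : Prop :=
  D.dlI ≫ D.buh (eta ≫ dl) (𝟙 D.uI)
    ≫ eqToHom (show D.bu (D.bu A A) D.uI = D.bu A (D.co D.uI (D.bu A D.uI)) by
        simp [D.coL, D.buA])
    ≫ D.buh (𝟙 A) (D.coh D.dlI (𝟙 (D.bu A D.uI)))
    ≫ D.buh (𝟙 A) (D.coh (D.buh (eta ≫ dl) (𝟙 D.uI)) (𝟙 (D.bu A D.uI)))
    ≫ eqToHom (show D.bu A (D.co (D.bu (D.bu A A) D.uI) (D.bu A D.uI))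
        = D.bu A (D.co (D.bu A (D.bu A D.uI)) (D.bu A D.uI)) by simp [D.buA])
    ≫ D.buh (𝟙 A) (D.zt A (D.bu A D.uI) A D.uI)
    ≫ eqToHom (show D.bu A (D.bu (D.co A A) (D.co (D.bu A D.uI) D.uI))
        = D.bu (D.bu (D.bu A (D.co A A)) A) D.uI by simp [D.coR, D.buA])
    ≫ D.buh (D.buh (D.buh (𝟙 A) mu) (𝟙 A)) (𝟙 D.uI)
  = D.dlI ≫ D.buh eta (𝟙 D.uI) ≫ D.buh dl (𝟙 D.uI) ≫ D.buh (D.buh dl (𝟙 A)) (𝟙 D.uI)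

/-- Axiom (RRC), obtained from (LLC) by replacing `∘` by its opposite. -/
def RRCeq (A : M) (mu : D.co A A ⟶ A) (dl : A ⟶ D.bu A A) (ep : A ⟶ D.uJ) : Prop :=
  D.coh (D.coh (D.coh (𝟙 A) dl) (𝟙 A)) (𝟙 D.uJ)
    ≫ eqToHom (show D.co (D.co (D.co A (D.bu A A)) A) D.uJ
        = D.co A (D.co (D.bu A A) (D.bu (D.co A D.uJ) D.uJ)) by simp [D.coA, D.buR])
    ≫ D.coh (𝟙 A) (D.zt A A (D.co A D.uJ) D.uJ)
    ≫ D.coh (𝟙 A) (D.buh (eqToHom (D.coA A A D.uJ).symm ≫ D.coh (mu ≫ ep) (𝟙 D.uJ))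
        (𝟙 (D.co A D.uJ)))
    ≫ D.coh (𝟙 A) (D.buh D.pw (𝟙 (D.co A D.uJ)))
    ≫ eqToHom (show D.co A (D.bu D.uJ (D.co A D.uJ)) = D.co (D.co A A) D.uJ by
        simp [D.buL, D.coA])
    ≫ D.coh (mu ≫ ep) (𝟙 D.uJ) ≫ D.pw
  = D.coh (D.coh mu (𝟙 A)) (𝟙 D.uJ) ≫ D.coh mu (𝟙 D.uJ) ≫ D.coh ep (𝟙 D.uJ) ≫ D.pw

/-- Axiom (RLC), obtained from (LRC) by replacing `∘` by its opposite. -/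
def RLCeq (A : M) (mu : D.co A A ⟶ A) (dl : A ⟶ D.bu A A) (ep : A ⟶ D.uJ) : Prop :=
  D.coh (D.coh (D.coh (𝟙 A) dl) (𝟙 A)) (𝟙 D.uJ)
    ≫ eqToHom (show D.co (D.co (D.co A (D.bu A A)) A) D.uJ
        = D.co A (D.co (D.bu A A) (D.bu D.uJ (D.co A D.uJ))) by simp [D.coA, D.buL])
    ≫ D.coh (𝟙 A) (D.zt A A D.uJ (D.co A D.uJ))
    ≫ D.coh (𝟙 A) (D.buh (𝟙 (D.co A D.uJ))
        (eqToHom (D.coA A A D.uJ).symm ≫ D.coh (mu ≫ ep) (𝟙 D.uJ)))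
    ≫ D.coh (𝟙 A) (D.buh (𝟙 (D.co A D.uJ)) D.pw)
    ≫ eqToHom (show D.co A (D.bu (D.co A D.uJ) D.uJ) = D.co (D.co A A) D.uJ by
        simp [D.buR, D.coA])
    ≫ D.coh (mu ≫ ep) (𝟙 D.uJ) ≫ D.pw
  = D.coh (D.coh mu (𝟙 A)) (𝟙 D.uJ) ≫ D.coh mu (𝟙 D.uJ) ≫ D.coh ep (𝟙 D.uJ) ≫ D.pw

end Duo

/-- A right weak bimonoid in a duoidal category. -/
structure RWB {M : Type u} [Category.{v} M] (D : Duo M) where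
  A : M
  mu : D.co A A ⟶ A
  eta : D.uI ⟶ A
  dl : A ⟶ D.bu A A
  ep : A ⟶ D.uJ
  mu_assoc : D.coh mu (𝟙 A) ≫ mu = eqToHom (D.coA A A A) ≫ D.coh (𝟙 A) mu ≫ mu
  mu_unitL : eqToHom (D.coL A).symm ≫ D.coh eta (𝟙 A) ≫ mu = 𝟙 A
  mu_unitR : eqToHom (D.coR A).symm ≫ D.coh (𝟙 A) eta ≫ mu = 𝟙 A
  dl_coassoc : dl ≫ D.buh dl (𝟙 A) ≫ eqToHom (D.buA A A A) = dl ≫ D.buh (𝟙 A) dl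
  dl_counitL : dl ≫ D.buh ep (𝟙 A) ≫ eqToHom (D.buL A) = 𝟙 A
  dl_counitR : dl ≫ D.buh (𝟙 A) ep ≫ eqToHom (D.buR A) = 𝟙 A
  wb : D.WBeq A mu dl
  rru : D.RRUeq A mu eta dl
  lru : D.LRUeq A mu eta dl
  lrc : D.LRCeq A mu dl ep
  llc : D.LLCeq A mu dl ep

/-- A weak bimonoid: both a right weak bimonoid and a left weak bimonoid. -/
structure WBim {M : Type u} [Category.{v} M] (D : Duo M) extends RWB D where
  rlu : D.RLUeq A mu eta dl
  llu : D.LLUeq A mu eta dl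
  rlc : D.RLCeq A mu dl ep
  rrc : D.RRCeq A mu dl ep

/-- Idempotent morphisms split in `M`. -/
def SplitIdem (M : Type u) [Category.{v} M] : Prop :=
  ∀ ⦃X : M⦄ (e : X ⟶ X), e ≫ e = e →
    ∃ (Y : M) (p : X ⟶ Y) (i : Y ⟶ X), p ≫ i = e ∧ i ≫ p = 𝟙 Y

namespace RWB

variable {M : Type u} [Category.{v} M] {D : Duo M} (W : RWB D)

/-- The object `J∘A`. -/
def JA : M := D.co D.uJ W.A

/-- The idempotent morphism `⊓^R_∘ :=
((J∘A)•ϖ).((J∘A)•(J∘(ε.μ))).ζ.(J∘A∘(Δ.η)) : J∘A ⟶ J∘A`. -/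
def sqcapR : W.JA ⟶ W.JA :=
  eqToHom (show W.JA = D.co W.JA D.uI by simp [D.coR])
    ≫ D.coh (𝟙 W.JA) (W.eta ≫ W.dl)
    ≫ eqToHom (show D.co W.JA (D.bu W.A W.A)
        = D.co (D.bu D.uJ W.JA) (D.bu W.A W.A) by simp [D.buL])
    ≫ D.zt D.uJ W.JA W.A W.A
    ≫ D.buh (𝟙 W.JA) (eqToHom (D.coA D.uJ W.A W.A) ≫ D.coh (𝟙 D.uJ) (W.mu ≫ W.ep))
    ≫ D.buh (𝟙 W.JA) D.pw
    ≫ eqToHom (D.buR W.JA)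

/-- The natural idempotent `χ^R_{F,G} = (φ•γ).ζ.((F•G)∘(Δ.η))` on `F•G`, for right
`A`-modules `(F,f)` and `(G,g)`. -/
def chiR (F G : M) (f : D.co F W.A ⟶ F) (g : D.co G W.A ⟶ G) :
    D.bu F G ⟶ D.bu F G :=
  eqToHom (show D.bu F G = D.co (D.bu F G) D.uI by simp [D.coR])
    ≫ D.coh (𝟙 (D.bu F G)) (W.eta ≫ W.dl)
    ≫ D.zt F G W.A W.A
    ≫ D.buh f g

/-- The morphism `J∘η : J ⟶ J∘A`. -/
def jeta : D.uJ ⟶ W.JA :=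
  eqToHom (D.coR D.uJ).symm ≫ D.coh (𝟙 D.uJ) W.eta

/-- The morphism `(π^R_∘).(τ∘A) : A ⟶ R_∘` needs `τ∘A : A ⟶ J∘A`. -/
def tauA : W.A ⟶ W.JA :=
  eqToHom (D.coL W.A).symm ≫ D.coh D.tau (𝟙 W.A)

section Retract

variable (R : M) (p : W.JA ⟶ R) (i : R ⟶ W.JA)

/-- The right `A`-action `γ_A = π^R_∘.(J∘μ).(ι^R_∘ ∘ A)` on the retract `R_∘`. -/
def gamA : D.co R W.A ⟶ R :=
  D.coh i (𝟙 W.A) ≫ eqToHom (D.coA D.uJ W.A W.A) ≫ D.coh (𝟙 D.uJ) W.mu ≫ p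

/-- The left `J`-action `γ_J = π^R_∘.(ϖ∘A).(J∘ι^R_∘)` on the retract `R_∘`. -/
def gamJ : D.co D.uJ R ⟶ R :=
  D.coh (𝟙 D.uJ) i ≫ eqToHom (D.coA D.uJ D.uJ W.A).symm ≫ D.coh D.pw (𝟙 W.A) ≫ p

/-- The multiplication `μ^R_∘ = (R∘•ϖ).(R∘•(J∘ε)).(R∘•ι^R_∘).χ^R_{R∘,R∘}`. -/
def muR : D.bu R R ⟶ R :=
  W.chiR R R (W.gamA R p i) (W.gamA R p i)
    ≫ D.buh (𝟙 R) i
    ≫ D.buh (𝟙 R) (D.coh (𝟙 D.uJ) W.ep)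
    ≫ D.buh (𝟙 R) D.pw
    ≫ eqToHom (D.buR R)

/-- The unit `η^R_∘ = π^R_∘.(J∘η)`. -/
def etaR : D.uJ ⟶ R := W.jeta ≫ p

/-- The comultiplication `Δ^R_∘ = χ^R_{R∘,R∘}.(R∘•π^R_∘).(R∘•(J∘η))`. -/
def DeltaR : R ⟶ D.bu R R :=
  eqToHom (D.buR R).symm
    ≫ D.buh (𝟙 R) W.jeta
    ≫ D.buh (𝟙 R) p
    ≫ W.chiR R R (W.gamA R p i) (W.gamA R p i)

/-- The counit `ε^R_∘ = ϖ.(J∘ε).ι^R_∘`. -/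
def epsR : R ⟶ D.uJ := i ≫ D.coh (𝟙 D.uJ) W.ep ≫ D.pw

end Retract

/-- The comultiplication-type morphism `ζ.(J∘Δ) : J∘A ⟶ (J∘A)•(J∘A)`. -/
def coact0 : W.JA ⟶ D.bu W.JA W.JA :=
  D.coh (𝟙 D.uJ) W.dl
    ≫ eqToHom (show D.co D.uJ (D.bu W.A W.A)
        = D.co (D.bu D.uJ D.uJ) (D.bu W.A W.A) by simp [D.buL])
    ≫ D.zt D.uJ D.uJ W.A W.A

end RWB

namespace RWB

variable {M : Type u} [Category.{v} M] {D : Duo M} (W : RWB D)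

/-- The morphism `ϑ^R := ((J∘A)•ϖ).((J∘A)•(J∘(ε.μ))).ζ.(J∘A∘Δ) : J∘A∘A ⟶ J∘A`. -/
def thetaR : D.co W.JA W.A ⟶ W.JA :=
  D.coh (𝟙 W.JA) W.dl
    ≫ eqToHom (show D.co W.JA (D.bu W.A W.A)
        = D.co (D.bu D.uJ W.JA) (D.bu W.A W.A) by simp [D.buL])
    ≫ D.zt D.uJ W.JA W.A W.A
    ≫ D.buh (𝟙 W.JA) (eqToHom (D.coA D.uJ W.A W.A) ≫ D.coh (𝟙 D.uJ) (W.mu ≫ W.ep))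
    ≫ D.buh (𝟙 W.JA) D.pw
    ≫ eqToHom (D.buR W.JA)

/-- The morphism `J∘μ : J∘A∘A ⟶ J∘A`. -/
def Jmu : D.co W.JA W.A ⟶ W.JA :=
  eqToHom (D.coA D.uJ W.A W.A) ≫ D.coh (𝟙 D.uJ) W.mu

/-- The morphism `J∘A∘η : J∘A ⟶ J∘A∘A`. -/
def JAeta : W.JA ⟶ D.co W.JA W.A :=
  eqToHom (show W.JA = D.co W.JA D.uI by simp [D.coR]) ≫ D.coh (𝟙 W.JA) W.eta

/-- The left `J`-action on `J∘A` given by `ϖ∘A`. -/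
def actJ1 : D.co D.uJ W.JA ⟶ W.JA :=
  eqToHom (show D.co D.uJ W.JA = D.co (D.co D.uJ D.uJ) W.A by simp [RWB.JA, D.coA])
    ≫ D.coh D.pw (𝟙 W.A)

/-- The left `J`-action on `J∘A∘A` given by `ϖ∘A∘A`. -/
def actJ2 : D.co D.uJ (D.co W.JA W.A) ⟶ D.co W.JA W.A :=
  eqToHom (show D.co D.uJ (D.co W.JA W.A)
      = D.co (D.co (D.co D.uJ D.uJ) W.A) W.A by simp [RWB.JA, D.coA])
    ≫ D.coh (D.coh D.pw (𝟙 W.A)) (𝟙 W.A)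

end RWB

namespace Duo

variable {M : Type u} [Category.{v} M] (D : Duo M)

lemma coh_eqToHom {X X' Y Y' : M} (h : X = X') (k : Y = Y') :
    D.coh (eqToHom h) (eqToHom k) = eqToHom (by rw [h, k]) := by
  subst h k; simp [D.coh_id]

lemma coh_eqToHom_id {X X' : M} (h : X = X') (Y : M) :
    D.coh (eqToHom h) (𝟙 Y) = eqToHom (by rw [h]) :=
  D.coh_eqToHom h rfl

lemma coh_id_eqToHom (X : M) {Y Y' : M} (k : Y = Y') :
    D.coh (𝟙 X) (eqToHom k) = eqToHom (by rw [k]) :=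
  D.coh_eqToHom rfl k

lemma buh_eqToHom {X X' Y Y' : M} (h : X = X') (k : Y = Y') :
    D.buh (eqToHom h) (eqToHom k) = eqToHom (by rw [h, k]) := by
  subst h k; simp [D.buh_id]

lemma coh_comp_id {X Y Z : M} (f : X ⟶ Y) (g : Y ⟶ Z) (V : M) :
    D.coh (f ≫ g) (𝟙 V) = D.coh f (𝟙 V) ≫ D.coh g (𝟙 V) := by
  rw [← D.coh_comp, Category.comp_id]

lemma coh_id_comp (V : M) {X Y Z : M} (f : X ⟶ Y) (g : Y ⟶ Z) :
    D.coh (𝟙 V) (f ≫ g) = D.coh (𝟙 V) f ≫ D.coh (𝟙 V) g := by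
  rw [← D.coh_comp, Category.comp_id]

lemma buh_id_comp (V : M) {X Y Z : M} (f : X ⟶ Y) (g : Y ⟶ Z) :
    D.buh (𝟙 V) (f ≫ g) = D.buh (𝟙 V) f ≫ D.buh (𝟙 V) g := by
  rw [← D.buh_comp, Category.comp_id]

lemma coh_exchange {X X' Y Y' : M} (f : X ⟶ X') (g : Y ⟶ Y') :
    D.coh f (𝟙 Y) ≫ D.coh (𝟙 X') g = D.coh (𝟙 X) g ≫ D.coh f (𝟙 Y') := by
  simp only [← D.coh_comp, Category.comp_id, Category.id_comp]

/-- For `h : X∘C ⟶ J`, the morphism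
`((J∘A)•h).ζ : X∘(A•C) = (J•X)∘(A•C) ⟶ (J∘A)•J = J∘A`. -/
def contract (X A C : M) (h : D.co X C ⟶ D.uJ) : D.co X (D.bu A C) ⟶ D.co D.uJ A :=
  D.coh (eqToHom (D.buL X).symm) (𝟙 (D.bu A C)) ≫ D.zt D.uJ X A C
    ≫ D.buh (𝟙 (D.co D.uJ A)) h ≫ eqToHom (D.buR (D.co D.uJ A))

lemma coh_contract {X X' : M} (f : X ⟶ X') (A C : M) (h : D.co X' C ⟶ D.uJ) :
    D.coh f (𝟙 (D.bu A C)) ≫ D.contract X' A C h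
      = D.contract X A C (D.coh f (𝟙 C) ≫ h) := by
  have hf : f ≫ eqToHom (D.buL X').symm
      = eqToHom (D.buL X).symm ≫ D.buh (𝟙 D.uJ) f := by simp [D.buh_unitL]
  have hz := D.zt_nat (𝟙 D.uJ) f (𝟙 A) (𝟙 C)
  rw [D.buh_id, D.coh_id] at hz
  simp only [contract, buh_id_comp, Category.assoc]
  rw [← Category.assoc (D.coh f _), ← coh_comp_id, hf, coh_comp_id, Category.assoc,
    reassoc_of% hz]

/-- The unit axiom for `ϖ` on the left, with the unitors moved to one side. -/
lemma eqToHom_zt_pw_left (X : M) :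
    eqToHom (show D.co D.uJ X = D.co (D.bu D.uJ D.uJ) (D.bu D.uJ X) by simp [D.buL])
      ≫ D.zt D.uJ D.uJ D.uJ X ≫ D.buh D.pw (𝟙 (D.co D.uJ X))
      = eqToHom (D.buL (D.co D.uJ X)).symm := by
  have h := D.zt_unitC D.uJ X
  rw [← cancel_mono (eqToHom (D.buL (D.co D.uJ X)))]
  simpa using h

/-- The unit axiom for `ϖ` on the right, with the unitors moved to one side. -/
lemma zt_buh_pw_right (Y : M) :
    D.coh (eqToHom (D.buL D.uJ).symm) (𝟙 (D.bu Y D.uJ)) ≫ D.zt D.uJ D.uJ Y D.uJ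
      ≫ D.buh (𝟙 (D.co D.uJ Y)) D.pw ≫ eqToHom (D.buR (D.co D.uJ Y))
      = D.coh (𝟙 D.uJ) (eqToHom (D.buR Y)) := by
  have h := D.zt_unitD D.uJ Y
  rw [coh_id_eqToHom, coh_eqToHom_id,
    ← cancel_epi (eqToHom (show D.co D.uJ Y = D.co D.uJ (D.bu Y D.uJ) by simp [D.buR]))]
  simpa using h

/-- `contract` is a morphism of left `J`-modules. -/
lemma contract_linear (X A C : M) (h : D.co X C ⟶ D.uJ) :
    D.coh (𝟙 D.uJ) (D.contract X A C h) ≫ eqToHom (D.coA D.uJ D.uJ A).symm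
        ≫ D.coh D.pw (𝟙 A)
      = eqToHom (D.coA D.uJ X (D.bu A C)).symm
        ≫ D.contract (D.co D.uJ X) A C
          (eqToHom (D.coA D.uJ X C) ≫ D.coh (𝟙 D.uJ) h ≫ D.pw) := by
  set g : D.co D.uJ (D.co D.uJ A) ⟶ D.co D.uJ A :=
    eqToHom (D.coA D.uJ D.uJ A).symm ≫ D.coh D.pw (𝟙 A) with hg
  have hl : D.coh (𝟙 D.uJ) (D.contract X A C h) ≫ g
      = D.coh (eqToHom (D.buL D.uJ).symm)
          (D.coh (eqToHom (D.buL X).symm) (𝟙 (D.bu A C)) ≫ D.zt D.uJ X A C)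
        ≫ D.zt D.uJ D.uJ (D.co D.uJ A) (D.co X C)
        ≫ D.buh g (D.coh (𝟙 D.uJ) h ≫ D.pw) ≫ eqToHom (D.buR (D.co D.uJ A)) := by
    have hu := D.zt_buh_pw_right (D.co D.uJ A)
    have hz := D.zt_nat (𝟙 D.uJ) (𝟙 D.uJ) (𝟙 (D.co D.uJ A)) h
    rw [D.buh_id, D.coh_id] at hz
    have he := D.coh_exchange (eqToHom (D.buL D.uJ).symm) (D.buh (𝟙 (D.co D.uJ A)) h)
    have hr : eqToHom (D.buR (D.co D.uJ (D.co D.uJ A))) ≫ g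
        = D.buh g (𝟙 D.uJ) ≫ eqToHom (D.buR (D.co D.uJ A)) := by simp [D.buh_unitR]
    have hs := D.coh_comp (𝟙 D.uJ) (eqToHom (D.buL D.uJ).symm)
      (D.coh (eqToHom (D.buL X).symm) (𝟙 (D.bu A C)) ≫ D.zt D.uJ X A C) (𝟙 _)
    rw [Category.id_comp, Category.comp_id] at hs
    rw [contract, ← Category.assoc (D.coh _ _) (D.zt _ _ _ _), coh_id_comp,
      D.coh_id_comp D.uJ (D.buh (𝟙 (D.co D.uJ A)) h), ← hu, hs]
    simp only [Category.assoc, hr]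
    rw [← reassoc_of% he, reassoc_of% hz]
    congr 3
    simp only [← Category.assoc, ← D.buh_comp, Category.id_comp, Category.comp_id]
  have hr : eqToHom (D.coA D.uJ X (D.bu A C)).symm
        ≫ D.contract (D.co D.uJ X) A C
          (eqToHom (D.coA D.uJ X C) ≫ D.coh (𝟙 D.uJ) h ≫ D.pw)
      = D.coh (eqToHom (D.buL D.uJ).symm)
          (D.coh (eqToHom (D.buL X).symm) (𝟙 (D.bu A C)) ≫ D.zt D.uJ X A C)
        ≫ D.zt D.uJ D.uJ (D.co D.uJ A) (D.co X C)
        ≫ D.buh g (D.coh (𝟙 D.uJ) h ≫ D.pw) ≫ eqToHom (D.buR (D.co D.uJ A)) := by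
    have hz := D.zt_nat D.pw (𝟙 (D.co D.uJ X)) (𝟙 A) (𝟙 C)
    rw [D.buh_id, D.coh_id] at hz
    have ha := D.zt_assoc1 D.uJ D.uJ D.uJ X A C
    have hs := D.coh_comp (eqToHom (D.buL D.uJ).symm) (𝟙 _)
      (D.coh (eqToHom (D.buL X).symm) (𝟙 (D.bu A C))) (D.zt D.uJ X A C)
    rw [Category.comp_id] at hs
    have he : eqToHom (show D.bu (D.co D.uJ (D.co D.uJ A)) (D.co D.uJ (D.co X C))
          = D.bu (D.co (D.co D.uJ D.uJ) A) (D.co (D.co D.uJ X) C) by simp [D.coA])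
        = D.buh (eqToHom (D.coA D.uJ D.uJ A).symm) (eqToHom (D.coA D.uJ X C).symm) :=
      (D.buh_eqToHom _ _).symm
    rw [contract, ← eqToHom_zt_pw_left, coh_comp_id, coh_comp_id]
    simp only [Category.assoc]
    rw [reassoc_of% hz, reassoc_of% ha, he, hs, coh_eqToHom_id, coh_eqToHom_id, coh_eqToHom]
    simp only [eqToHom_trans_assoc, Category.assoc]
    congr 3
    simp only [← Category.assoc, ← D.buh_comp]
    simp [hg]
  rw [hl, hr]

/-- The free left `J`-action `ϖ∘X` on `J∘X`. -/
def freeAct (X : M) : D.co D.uJ (D.co D.uJ X) ⟶ D.co D.uJ X :=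
  eqToHom (D.coA D.uJ D.uJ X).symm ≫ D.coh D.pw (𝟙 X)

lemma coh_id_coh {X X' Y Y' : M} (Z : M) (f : X ⟶ X') (g : Y ⟶ Y') :
    D.coh (𝟙 Z) (D.coh f g)
      = eqToHom (D.coA Z X Y).symm ≫ D.coh (D.coh (𝟙 Z) f) g
        ≫ eqToHom (D.coA Z X' Y') := by
  simp [D.coh_assoc]

lemma freeAct_naturality {X Y : M} (f : X ⟶ Y) :
    D.coh (𝟙 D.uJ) (D.coh (𝟙 D.uJ) f) ≫ D.freeAct Y
      = D.freeAct X ≫ D.coh (𝟙 D.uJ) f := by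
  simp [freeAct, coh_id_coh, D.coh_id, D.coh_exchange]

lemma coh_freeAct (X Y : M) :
    D.coh (D.freeAct X) (𝟙 Y) ≫ eqToHom (D.coA D.uJ X Y)
      = eqToHom (D.coA D.uJ (D.co D.uJ X) Y) ≫ D.coh (𝟙 D.uJ) (eqToHom (D.coA D.uJ X Y))
        ≫ D.freeAct (D.co X Y) := by
  simp [freeAct, coh_comp_id, D.coh_assoc, D.coh_id, coh_eqToHom_id, coh_id_eqToHom]

lemma coh_pw_pw : D.coh (𝟙 D.uJ) D.pw ≫ D.pw
    = eqToHom (D.coA D.uJ D.uJ D.uJ).symm ≫ D.coh D.pw (𝟙 D.uJ) ≫ D.pw := by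
  simp [D.pw_assoc]

end Duo

namespace RWB

variable {M : Type u} [Category.{v} M] {D : Duo M} (W : RWB D)

/-- `J∘μ`, with the source and target of `Jmu` written out. -/
def freeMul : D.co (D.co D.uJ W.A) W.A ⟶ D.co D.uJ W.A :=
  eqToHom (D.coA D.uJ W.A W.A) ≫ D.coh (𝟙 D.uJ) W.mu

/-- `J∘A∘η`, with the source and target of `JAeta` written out. -/
def freeUnit : D.co D.uJ W.A ⟶ D.co (D.co D.uJ W.A) W.A :=
  eqToHom (D.coR (D.co D.uJ W.A)).symm ≫ D.coh (𝟙 (D.co D.uJ W.A)) W.eta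

/-- The pairing `ϖ.(J∘(ε.μ)) : J∘A∘A ⟶ J`. -/
def pairing : D.co (D.co D.uJ W.A) W.A ⟶ D.uJ :=
  eqToHom (D.coA D.uJ W.A W.A) ≫ D.coh (𝟙 D.uJ) (W.mu ≫ W.ep) ≫ D.pw

/-- `ϑ^R`, expressed through `contract`. -/
def freeTheta : D.co (D.co D.uJ W.A) W.A ⟶ D.co D.uJ W.A :=
  D.coh (𝟙 (D.co D.uJ W.A)) W.dl ≫ D.contract (D.co D.uJ W.A) W.A W.A W.pairing

/-- The left `J`-action `ϖ∘A∘A` on `J∘A∘A`. -/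
def freeAct₂ : D.co D.uJ (D.co (D.co D.uJ W.A) W.A) ⟶ D.co (D.co D.uJ W.A) W.A :=
  eqToHom (D.coA D.uJ (D.co D.uJ W.A) W.A).symm ≫ D.coh (D.freeAct W.A) (𝟙 W.A)

lemma freeTheta_eq :
    W.freeTheta = D.coh (𝟙 (D.co D.uJ W.A)) W.dl
      ≫ eqToHom (show D.co (D.co D.uJ W.A) (D.bu W.A W.A)
          = D.co (D.bu D.uJ (D.co D.uJ W.A)) (D.bu W.A W.A) by simp [D.buL])
      ≫ D.zt D.uJ (D.co D.uJ W.A) W.A W.A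
      ≫ D.buh (𝟙 (D.co D.uJ W.A))
          (eqToHom (D.coA D.uJ W.A W.A) ≫ D.coh (𝟙 D.uJ) (W.mu ≫ W.ep))
      ≫ D.buh (𝟙 (D.co D.uJ W.A)) D.pw
      ≫ eqToHom (D.buR (D.co D.uJ W.A)) := by
  simp only [freeTheta, Duo.contract, pairing, Duo.coh_eqToHom_id, Duo.buh_id_comp,
    Category.assoc]

lemma thetaR_eq : W.thetaR = W.freeTheta :=
  W.freeTheta_eq.symm

lemma freeAct₂_eq :
    W.freeAct₂ = eqToHom (show D.co D.uJ (D.co (D.co D.uJ W.A) W.A)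
        = D.co (D.co (D.co D.uJ D.uJ) W.A) W.A by simp [D.coA])
      ≫ D.coh (D.coh D.pw (𝟙 W.A)) (𝟙 W.A) := by
  simp [freeAct₂, Duo.freeAct, D.coh_comp_id, D.coh_eqToHom_id]

lemma actJ2_eq : W.actJ2 = W.freeAct₂ :=
  W.freeAct₂_eq.symm

lemma sqcapR_eq : W.sqcapR = W.freeUnit ≫ W.freeTheta := by
  rw [freeTheta_eq, freeUnit, Category.assoc, ← Category.assoc (D.coh _ W.eta), ← D.coh_id_comp]
  rfl

lemma freeUnit_freeMul : W.freeUnit ≫ W.freeMul = 𝟙 (D.co D.uJ W.A) := by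
  have h := congrArg (D.coh (𝟙 D.uJ)) W.mu_unitR
  rw [D.coh_id, D.coh_id_comp, D.coh_id_comp, D.coh_id_eqToHom, D.coh_id_coh, D.coh_id] at h
  simpa [freeUnit, freeMul] using h

/-- (LLC) states that the pairing does not distinguish `ϑ^R` from `J∘μ`. -/
lemma freeTheta_pairing :
    D.coh W.freeTheta (𝟙 W.A) ≫ W.pairing = D.coh W.freeMul (𝟙 W.A) ≫ W.pairing := by
  have h := W.llc
  simp only [Duo.LLCeq] at h
  simp only [freeTheta_eq, D.coh_comp_id, Category.assoc, D.coh_eqToHom_id, pairing,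
    eqToHom_trans_assoc, D.buh_id_comp] at h ⊢
  rw [h, freeMul]
  have ha := congrArg (D.coh (𝟙 D.uJ)) W.mu_assoc
  simp only [D.coh_id_comp, D.coh_id_eqToHom] at ha
  rw [← D.coh_id D.uJ W.A]
  simp [D.coh_comp_id, D.coh_id_comp, D.coh_assoc, D.coh_eqToHom_id, reassoc_of% ha]

lemma comp_sqcapR (f : D.co (D.co D.uJ W.A) W.A ⟶ D.co D.uJ W.A) :
    f ≫ W.freeUnit ≫ W.freeTheta
      = eqToHom (D.coR _).symm ≫ D.coh (𝟙 _) W.eta ≫ D.coh (𝟙 _) W.dl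
        ≫ D.contract _ W.A W.A (D.coh f (𝟙 W.A) ≫ W.pairing) := by
  rw [← D.coh_contract, ← reassoc_of% D.coh_exchange, ← reassoc_of% D.coh_exchange,
    D.coh_unitR, freeTheta, freeUnit]
  simp

lemma freeTheta_sqcapR :
    W.freeTheta ≫ W.freeUnit ≫ W.freeTheta = W.freeMul ≫ W.freeUnit ≫ W.freeTheta := by
  rw [comp_sqcapR, comp_sqcapR, freeTheta_pairing]

lemma freeAct_pairing :
    D.coh (D.freeAct W.A) (𝟙 W.A) ≫ W.pairing
      = eqToHom (D.coA D.uJ (D.co D.uJ W.A) W.A) ≫ D.coh (𝟙 D.uJ) W.pairing ≫ D.pw := by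
  have hn := D.freeAct_naturality (W.mu ≫ W.ep)
  have hf := D.coh_freeAct W.A W.A
  have hp : D.coh (𝟙 D.uJ) D.pw ≫ D.pw = D.freeAct D.uJ ≫ D.pw := by
    rw [D.coh_pw_pw, Duo.freeAct, Category.assoc]
  rw [pairing, D.coh_id_comp D.uJ (eqToHom _), D.coh_id_comp D.uJ (D.coh _ _), Category.assoc,
    Category.assoc, hp, reassoc_of% hn, reassoc_of% hf]

lemma freeMul_linear :
    D.coh (𝟙 D.uJ) W.freeMul ≫ D.freeAct W.A = W.freeAct₂ ≫ W.freeMul := by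
  have hf := D.coh_freeAct W.A W.A
  rw [freeAct₂, freeMul, D.coh_id_comp, Category.assoc, D.freeAct_naturality]
  simp [reassoc_of% hf]

lemma freeTheta_linear :
    D.coh (𝟙 D.uJ) W.freeTheta ≫ D.freeAct W.A = W.freeAct₂ ≫ W.freeTheta := by
  have hc := D.contract_linear (D.co D.uJ W.A) W.A W.A W.pairing
  rw [freeTheta, freeAct₂, Category.assoc, reassoc_of% D.coh_exchange, D.coh_contract,
    freeAct_pairing, D.coh_id_comp, Category.assoc, Duo.freeAct, hc]
  simp [D.coh_id_coh, D.coh_id]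

lemma freeUnit_linear :
    D.coh (𝟙 D.uJ) W.freeUnit ≫ W.freeAct₂ = D.freeAct W.A ≫ W.freeUnit := by
  have he := D.coh_exchange (D.freeAct W.A) W.eta
  rw [freeAct₂, freeUnit, D.coh_id_comp, D.coh_id_coh, D.coh_id, D.coh_id_eqToHom]
  simp [← he, D.coh_unitR]

lemma sqcapR_linear :
    D.coh (𝟙 D.uJ) (W.freeUnit ≫ W.freeTheta) ≫ D.freeAct W.A
      = D.freeAct W.A ≫ W.freeUnit ≫ W.freeTheta := by
  rw [D.coh_id_comp, Category.assoc, freeTheta_linear, ← Category.assoc, freeUnit_linear,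
    Category.assoc]

section Retract

variable {R : M} {p : D.co D.uJ W.A ⟶ R} {i : R ⟶ D.co D.uJ W.A}

lemma gamJ_eq : W.gamJ R p i = D.coh (𝟙 D.uJ) i ≫ D.freeAct W.A ≫ p := by
  rw [Duo.freeAct, Category.assoc]
  rfl

lemma retraction_linear (hpi : p ≫ i = W.freeUnit ≫ W.freeTheta) (hip : i ≫ p = 𝟙 R) :
    D.coh (𝟙 D.uJ) p ≫ W.gamJ R p i = D.freeAct W.A ≫ p := by
  rw [gamJ_eq, ← Category.assoc, ← D.coh_id_comp, hpi, ← Category.assoc, sqcapR_linear, ← hpi]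
  simp [hip]

lemma section_linear (hpi : p ≫ i = W.freeUnit ≫ W.freeTheta) (hip : i ≫ p = 𝟙 R) :
    D.coh (𝟙 D.uJ) i ≫ D.freeAct W.A = W.gamJ R p i ≫ i := by
  rw [gamJ_eq, Category.assoc, Category.assoc, hpi, ← sqcapR_linear, ← hpi, ← Category.assoc,
    ← D.coh_id_comp, reassoc_of% hip]

lemma freeMul_retraction (hpi : p ≫ i = W.freeUnit ≫ W.freeTheta) (hip : i ≫ p = 𝟙 R) :
    W.freeMul ≫ p = W.freeTheta ≫ p := by
  have h := W.freeTheta_sqcapR =≫ p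
  rw [← hpi] at h
  simpa [hip] using h.symm

end Retract

end RWB

/-- **Statement 9.**  For a right weak bimonoid `A` in a duoidal category with split
idempotents and a fixed splitting of `⊓^R_∘` through `R_∘`, the parallel pair
`(J∘μ, ϑ^R) : J∘A∘A ⟶ J∘A` followed by `π^R_∘ : J∘A ⟶ R_∘` is a contractible
coequalizer of left `J`-modules. -/
theorem contractible_coequalizer_of_J_modules
    {M : Type u} [Category.{v} M] (D : Duo M) (W : RWB D)
    (hsplit : SplitIdem M)
    (R : M) (p : W.JA ⟶ R) (i : R ⟶ W.JA)
    (hpi : p ≫ i = W.sqcapR) (hip : i ≫ p = 𝟙 R) :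
    -- (i)  π^R_∘ coequalizes the pair
    (W.Jmu ≫ p = W.thetaR ≫ p) ∧
    -- (ii)  ϑ^R.(J∘A∘η) = ι^R_∘.π^R_∘ = ⊓^R_∘
    (W.JAeta ≫ W.thetaR = p ≫ i) ∧
    -- (iii)  (J∘μ).(J∘A∘η) = id  and  π^R_∘.ι^R_∘ = id
    (W.JAeta ≫ W.Jmu = 𝟙 W.JA) ∧ (i ≫ p = 𝟙 R) ∧
    -- all morphisms involved are morphisms of left `J`-modules:
    (D.coh (𝟙 D.uJ) W.Jmu ≫ W.actJ1 = W.actJ2 ≫ W.Jmu) ∧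
    (D.coh (𝟙 D.uJ) W.thetaR ≫ W.actJ1 = W.actJ2 ≫ W.thetaR) ∧
    (D.coh (𝟙 D.uJ) p ≫ W.gamJ R p i = W.actJ1 ≫ p) ∧
    (D.coh (𝟙 D.uJ) W.JAeta ≫ W.actJ2 = W.actJ1 ≫ W.JAeta) ∧
    (D.coh (𝟙 D.uJ) i ≫ W.actJ1 = W.gamJ R p i ≫ i) := by
  have h := hpi.trans W.sqcapR_eq
  rw [W.thetaR_eq, W.actJ2_eq]
  exact ⟨W.freeMul_retraction h hip, h.symm, W.freeUnit_freeMul, hip, W.freeMul_linear,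
    W.freeTheta_linear, W.retraction_linear h hip, W.freeUnit_linear, W.section_linear h hip⟩
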